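/- Let X ⊆ 𝒜^ℤ be a bi-sided subshift, X_∞ ⊆ X a closed τ-invariant subset, and h : X × ℤ → ℂ continuous with compact support and self-adjoint. If x₀ ∈ X_∞ has dense orbit in X_∞ (i.e. cl{τ_k(x₀) : k∈ℤ} = X_∞), then for every x ∈ X_∞ one has sp(H_x^{X_∞}) ⊆ sp(H_{x₀}^{X_∞}); in particular, if every orbit in X_∞ is dense, the spectrum of H_x^{X_∞} is the same for all x ∈ X_∞. -/

import Mathlib

open scoped ENNReal

noncomputable section

/-- The shift action of `ℤ` on `𝒜^ℤ`: `(τ_k x)(n) = x(n - k)`. -/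
def tau {𝒜 : Type} (k : ℤ) (x : ℤ → 𝒜) : ℤ → 𝒜 := fun n => x (n - k)

/-- The Hilbert space `ℓ²(ℤ)`. -/
abbrev EllTwo : Type := lp (fun _ : ℤ => ℂ) 2

/-- A normal operator on a Hilbert space that is bounded below is invertible. -/
lemma isUnit_of_isStarNormal_of_norm_le {E : Type*} [NormedAddCommGroup E]
    [InnerProductSpace ℂ E] [CompleteSpace E] {T : E →L[ℂ] E} (hT : IsStarNormal T)
    {K : NNReal} (hK : ∀ v, ‖v‖ ≤ K * ‖T v‖) : IsUnit T := by
  have hanti : AntilipschitzWith K T := T.antilipschitz_of_bound hK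
  rw [ContinuousLinearMap.isUnit_iff_bijective,
    ContinuousLinearMap.bijective_iff_dense_range_and_antilipschitz]
  refine ⟨?_, K, hanti⟩
  rw [Submodule.topologicalClosure_eq_top_iff,
    ContinuousLinearMap.IsStarNormal.orthogonal_range hT]
  exact LinearMap.ker_eq_bot.mpr hanti.injective

lemma exists_norm_le_of_isUnit {E : Type*} [NormedAddCommGroup E] [NormedSpace ℂ E]
    {T : E →L[ℂ] E} (hT : IsUnit T) : ∃ K : NNReal, ∀ v, ‖v‖ ≤ K * ‖T v‖ := by
  obtain ⟨u, rfl⟩ := hT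
  refine ⟨‖(↑u⁻¹ : E →L[ℂ] E)‖₊, fun v => ?_⟩
  have huv : (↑u⁻¹ : E →L[ℂ] E) ((u : E →L[ℂ] E) v) = v := by
    rw [← mul_apply_eq_comp, u.inv_mul, one_apply_eq_self]
  calc ‖v‖ = ‖(↑u⁻¹ : E →L[ℂ] E) ((u : E →L[ℂ] E) v)‖ := by rw [huv]
    _ ≤ _ := (↑u⁻¹ : E →L[ℂ] E).le_opNorm _

/-- Translation on `ℓ²(ℤ)`: `(shift m v)(k) = v(k + m)`. -/
def shift (m : ℤ) (v : EllTwo) : EllTwo :=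
  ⟨fun k => v (k + m), by
    have hv := (memℓp_gen_iff (by norm_num)).mp (lp.memℓp v)
    exact (memℓp_gen_iff (by norm_num)).mpr ((Equiv.addRight m).summable_iff.mpr hv)⟩

lemma shift_apply (m : ℤ) (v : EllTwo) (k : ℤ) : shift m v k = v (k + m) := rfl

lemma norm_shift (m : ℤ) (v : EllTwo) : ‖shift m v‖ = ‖v‖ := by
  rw [lp.norm_eq_tsum_rpow (by norm_num), lp.norm_eq_tsum_rpow (by norm_num)]
  congr 1
  exact (Equiv.addRight m).tsum_eq (fun k => ‖v k‖ ^ (2 : ENNReal).toReal)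

lemma dense_span_single :
    Dense (Submodule.span ℂ (Set.range fun i : ℤ => (lp.single 2 i (1 : ℂ) : EllTwo)) :
      Set EllTwo) := by
  intro v
  refine mem_closure_of_tendsto (lp.hasSum_single (by norm_num) v)
    (Filter.Eventually.of_forall fun s => Submodule.sum_mem _ fun i _ => ?_)
  have hi : (lp.single 2 i (v i) : EllTwo) = v i • lp.single 2 i (1 : ℂ) := by
    rw [← lp.single_smul, smul_eq_mul, mul_one]
  rw [hi]
  exact Submodule.smul_mem _ _ (Submodule.subset_span ⟨i, rfl⟩)

section MatrixOperators

variable {a : ℤ → ℤ → ℂ} {H : EllTwo →L[ℂ] EllTwo}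

lemma apply_single_of_matrix (hH : ∀ v k, H v k = ∑' l, a k l * v l) (i k : ℤ) :
    H (lp.single 2 i 1) k = a k i := by
  rw [hH, tsum_eq_single i]
  · simp
  · intro l hl
    simp [hl]

lemma isSelfAdjoint_of_matrix (hH : ∀ v k, H v k = ∑' l, a k l * v l)
    (ha : ∀ k l, a l k = starRingEnd ℂ (a k l)) : IsSelfAdjoint H := by
  rw [ContinuousLinearMap.isSelfAdjoint_iff']
  refine ContinuousLinearMap.ext_on dense_span_single ?_
  rintro _ ⟨l, rfl⟩
  ext k
  have h1 : inner ℂ (lp.single 2 k (1 : ℂ) : EllTwo)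
      (ContinuousLinearMap.adjoint H (lp.single 2 l (1 : ℂ))) =
      inner ℂ (H (lp.single 2 k (1 : ℂ))) (lp.single 2 l (1 : ℂ) : EllTwo) :=
    ContinuousLinearMap.adjoint_inner_right H _ _
  rw [lp.inner_single_left, lp.inner_single_right, apply_single_of_matrix hH] at h1
  simp only [apply_single_of_matrix hH]
  simpa [ha k l] using h1

end MatrixOperators

section Families

variable {T : Type*} [TopologicalSpace T] {H : T → EllTwo →L[ℂ] EllTwo}

/-- A family of uniformly banded matrices with continuous entries is continuous on the standard
basis vectors of `ℓ²(ℤ)`. -/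
lemma continuous_apply_single {a : T → ℤ → ℤ → ℂ}
    (hH : ∀ t v k, H t v k = ∑' l, a t k l * v l)
    (hcont : ∀ k l, Continuous fun t => a t k l) {s : ℤ → Finset ℤ}
    (hs : ∀ t l, ∀ k ∉ s l, a t k l = 0) (l : ℤ) :
    Continuous fun t => H t (lp.single 2 l 1) := by
  have heq : ∀ t, H t (lp.single 2 l 1) = ∑ k ∈ s l, lp.single 2 k (a t k l) := by
    intro t
    ext j
    rw [apply_single_of_matrix (hH t), lp.coeFn_sum, Finset.sum_apply]
    simp only [lp.coeFn_single]
    rw [Finset.sum_pi_single]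
    split_ifs with hj
    · rfl
    · exact hs t l j hj
  simp_rw [heq]
  exact continuous_finsetSum _ fun k _ =>
    (lp.isometry_single (E := fun _ : ℤ => ℂ) (p := 2) k).continuous.comp (hcont k l)

/-- A uniform lower bound on a dense set of parameters extends to all parameters. -/
lemma norm_le_of_dense (hcont : ∀ l, Continuous fun t => H t (lp.single 2 l 1))
    {D : Set T} (hD : Dense D) {K : ℝ} (hK : ∀ t ∈ D, ∀ v, ‖v‖ ≤ K * ‖H t v‖) (t : T)
    (v : EllTwo) : ‖v‖ ≤ K * ‖H t v‖ := by
  have hclosed : IsClosed {v : EllTwo | ‖v‖ ≤ K * ‖H t v‖} :=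
    isClosed_le continuous_norm (by fun_prop)
  refine hclosed.closure_subset_iff.mpr ?_ (dense_span_single v)
  intro w hw
  have hwcont : Continuous fun t => H t w := by
    induction hw using Submodule.span_induction with
    | mem w hw => obtain ⟨l, rfl⟩ := hw; exact hcont l
    | zero => simpa using continuous_const
    | add u w _ _ hu hw => simpa only [map_add] using hu.fun_add hw
    | smul c w _ hw => simpa only [map_smul] using hw.fun_const_smul c
  have hclosed' : IsClosed {t : T | ‖w‖ ≤ K * ‖H t w‖} :=
    isClosed_le continuous_const (by fun_prop)
  exact hclosed'.closure_subset_iff.mpr (fun t ht => hK t ht w) (hD t)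

end Families

lemma tau_tau {𝒜 : Type} (k l : ℤ) (x : ℤ → 𝒜) : tau k (tau l x) = tau (k + l) x := by
  funext n
  simp only [tau]
  congr 1
  ring

lemma continuous_tau {𝒜 : Type} [TopologicalSpace 𝒜] (k : ℤ) :
    Continuous (tau k : (ℤ → 𝒜) → ℤ → 𝒜) :=
  continuous_pi fun n => continuous_apply (n - k)

/-- Covariance of the operators `H_x` under the shift. -/
lemma apply_eq_shift_of_tau {𝒜 : Type} {h : (ℤ → 𝒜) → ℤ → ℂ} {x : ℤ → 𝒜} {m : ℤ}
    {H H' : EllTwo →L[ℂ] EllTwo}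
    (hH : ∀ v k, H v k = ∑' l, h (tau l x) (k - l) * v l)
    (hH' : ∀ v k, H' v k = ∑' l, h (tau l (tau m x)) (k - l) * v l) (v : EllTwo) :
    H' v = shift m (H (shift (-m) v)) := by
  ext k
  rw [shift_apply, hH, hH']
  refine Eq.trans (tsum_congr fun l => ?_) ((Equiv.addRight m).tsum_eq _)
  rw [tau_tau, shift_apply, Equiv.coe_addRight, add_sub_add_right_eq_sub, add_neg_cancel_right]

lemma spectrum_subset_of_dense_orbit {𝒜 : Type} [TopologicalSpace 𝒜] {X Y : Set (ℤ → 𝒜)}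
    (hYX : Y ⊆ X) (hY : ∀ k : ℤ, ∀ x ∈ Y, tau k x ∈ Y) {h : (ℤ → 𝒜) → ℤ → ℂ}
    (hcont : ∀ k : ℤ, ContinuousOn (fun x => h x k) X)
    (hsupp : ∃ r > (0 : ℝ), ∀ (x : ℤ → 𝒜) (k : ℤ), (|k| : ℝ) > r → h x k = 0)
    (hsa : ∀ x ∈ X, ∀ k : ℤ, h (tau k x) (-k) = starRingEnd ℂ (h x k))
    {H : (x : ℤ → 𝒜) → x ∈ Y → (EllTwo →L[ℂ] EllTwo)}
    (hH : ∀ (x : ℤ → 𝒜) (hx : x ∈ Y) (v : EllTwo) (k : ℤ),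
      (H x hx v) k = ∑' l : ℤ, h (tau l x) (k - l) * v l)
    {x₀ : ℤ → 𝒜} (hx₀ : x₀ ∈ Y) (hdense : closure (Set.range fun k => tau k x₀) = Y)
    {x : ℤ → 𝒜} (hx : x ∈ Y) : spectrum ℂ (H x hx) ⊆ spectrum ℂ (H x₀ hx₀) := by
  intro z
  contrapose!
  rw [spectrum.notMem_iff, spectrum.notMem_iff]
  intro hunit
  obtain ⟨K, hK⟩ := exists_norm_le_of_isUnit hunit
  have happly : ∀ (y : ℤ → 𝒜) (hy : y ∈ Y) (v : EllTwo),
      (algebraMap ℂ (EllTwo →L[ℂ] EllTwo) z - H y hy) v = z • v - H y hy v := by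
    intro y hy v
    simp [Algebra.algebraMap_eq_smul_one]
  have hself : IsSelfAdjoint (H x hx) := by
    refine isSelfAdjoint_of_matrix (hH x hx) fun k l => ?_
    rw [← hsa _ (hYX (hY _ _ hx)), tau_tau, neg_sub, sub_add_cancel]
  have hnormal : IsStarNormal (algebraMap ℂ (EllTwo →L[ℂ] EllTwo) z - H x hx) := by
    constructor
    rw [star_sub, hself.star_eq, ← algebraMap_star_comm]
    exact ((Algebra.commute_algebraMap_left _ _).sub_left
      ((Algebra.commute_algebraMap_right _ _).sub_right (Commute.refl _)))
  refine isUnit_of_isStarNormal_of_norm_le hnormal (K := K) ?_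
  obtain ⟨r, -, hr⟩ := hsupp
  have hbasis : ∀ l, Continuous fun y : Y => H y y.2 (lp.single 2 l 1) := by
    refine continuous_apply_single (a := fun y k l => h (tau l y) (k - l))
      (s := fun l => Finset.Icc (l - ⌈r⌉) (l + ⌈r⌉)) (fun y => hH y y.2) (fun k l => ?_) ?_
    · exact (hcont (k - l)).comp_continuous ((continuous_tau l).comp continuous_subtype_val)
        fun y => hYX (hY _ _ y.2)
    · intro y l k hk
      refine hr _ _ ?_
      by_contra! hle
      have h1 : |k - l| ≤ ⌈r⌉ := by
        have h2 := hle.trans (Int.le_ceil r)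
        exact_mod_cast h2
      rw [abs_le] at h1
      exact hk (Finset.mem_Icc.mpr ⟨by linarith, by linarith⟩)
  refine norm_le_of_dense (T := Y)
    (H := fun y => algebraMap ℂ (EllTwo →L[ℂ] EllTwo) z - H y y.2)
    (D := Set.range fun k => ⟨tau k x₀, hY k x₀ hx₀⟩) (fun l => ?_) ?_ ?_ ⟨x, hx⟩
  · simp only [happly]
    exact continuous_const.sub (hbasis l)
  · rw [Subtype.dense_iff, ← Set.range_comp]
    exact hdense.ge
  · rintro _ ⟨m, rfl⟩ v
    have hcov : (algebraMap ℂ (EllTwo →L[ℂ] EllTwo) z - H (tau m x₀) (hY m x₀ hx₀)) v =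
        shift m ((algebraMap ℂ (EllTwo →L[ℂ] EllTwo) z - H x₀ hx₀) (shift (-m) v)) := by
      rw [happly, happly, apply_eq_shift_of_tau (hH x₀ hx₀) (hH _ (hY m x₀ hx₀))]
      ext k
      simp only [shift_apply, lp.coeFn_sub, lp.coeFn_smul, Pi.sub_apply, Pi.smul_apply,
        add_neg_cancel_right]
    rw [hcov, norm_shift, ← norm_shift (-m) v]
    exact hK _

/-- **Spectral inclusion along dense orbits** (Remark 5.3 of the paper): if `x₀ ∈ X∞` has
dense orbit in the closed invariant set `X∞`, then `sp(H_x^{X∞}) ⊆ sp(H_{x₀}^{X∞})` for every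
`x ∈ X∞`; in particular if every orbit of `X∞` is dense (minimality), the spectrum of
`H_x^{X∞}` does not depend on `x ∈ X∞`. -/
theorem subshift_dense_orbit_spectral_inclusion
    {𝒜 : Type} [Fintype 𝒜] [TopologicalSpace 𝒜] [DiscreteTopology 𝒜]
    (X : Set (ℤ → 𝒜)) (hXcl : IsClosed X) (hXinv : ∀ (k : ℤ), ∀ x ∈ X, tau k x ∈ X)
    (Xinf : Set (ℤ → 𝒜)) (hXinfX : Xinf ⊆ X) (hXinfcl : IsClosed Xinf)
    (hXinfinv : ∀ (k : ℤ), ∀ x ∈ Xinf, tau k x ∈ Xinf)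
    (h : (ℤ → 𝒜) → ℤ → ℂ)
    (hcont : ∀ k : ℤ, ContinuousOn (fun x => h x k) X)
    (hsupp : ∃ r > (0 : ℝ), ∀ (x : ℤ → 𝒜) (k : ℤ), (|k| : ℝ) > r → h x k = 0)
    (hsa : ∀ x ∈ X, ∀ k : ℤ, h (tau k x) (-k) = starRingEnd ℂ (h x k))
    -- the family H_x^{X∞} on ℓ²(ℤ)
    (Hfam : (x : ℤ → 𝒜) → x ∈ Xinf → (lp (fun _ : ℤ => ℂ) 2 →L[ℂ] lp (fun _ : ℤ => ℂ) 2))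
    (hHfam : ∀ (x : ℤ → 𝒜) (hx : x ∈ Xinf) (v : lp (fun _ : ℤ => ℂ) 2) (k : ℤ),
      (Hfam x hx v) k = ∑' l : ℤ, h (tau l x) (k - l) * v l)
    -- x₀ has dense orbit in X∞
    (x₀ : ℤ → 𝒜) (hx₀ : x₀ ∈ Xinf)
    (hdense : closure (Set.range fun k => tau k x₀) = Xinf) :
    (∀ (x : ℤ → 𝒜) (hx : x ∈ Xinf),
      spectrum ℂ (Hfam x hx) ⊆ spectrum ℂ (Hfam x₀ hx₀)) ∧
    ((∀ x ∈ Xinf, closure (Set.range fun k => tau k x) = Xinf) →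
      ∀ (x : ℤ → 𝒜) (hx : x ∈ Xinf) (y : ℤ → 𝒜) (hy : y ∈ Xinf),
        spectrum ℂ (Hfam x hx) = spectrum ℂ (Hfam y hy)) := by
  have key : ∀ (x : ℤ → 𝒜) (hx : x ∈ Xinf) (y : ℤ → 𝒜) (hy : y ∈ Xinf),
      closure (Set.range fun k => tau k y) = Xinf →
        spectrum ℂ (Hfam x hx) ⊆ spectrum ℂ (Hfam y hy) := fun x hx y hy hyd =>
    spectrum_subset_of_dense_orbit hXinfX hXinfinv hcont hsupp hsa hHfam hy hyd hx
  exact ⟨fun x hx => key x hx x₀ hx₀ hdense, fun hmin x hx y hy =>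
    (key x hx y hy (hmin y hy)).antisymm (key y hy x hx (hmin x hx))⟩


end
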